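/- arXiv:0709.3874 — 2 statements merged into one kernel-verified Lean document; each statement's English description precedes it below -/
import Mathlib

section
/- Let V be a ℤ-graded commutative algebra over ℚ and let Δ: V → V be a degree-1 linear operator with Δ∘Δ = 0. Then Δ acts as a graded derivation of its own antibracket: for all homogeneous a, b ∈ V, Δ({a,b}) = {Δ(a), b} + (−1)^{|a|+1} {a, Δ(b)}. -/
/-- A ℤ-graded commutative algebra over ℚ: an associative unital ℚ-algebra `V`
together with a grading by ℚ-submodules into which `V` decomposes as a direct
sum, such that the product is graded and satisfies the Koszul sign rule
`a * b = (-1)^(|a| * |b|) • (b * a)` on homogeneous elements. -/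
structure GradedCommAlg (V : Type*) [Ring V] [Algebra ℚ V] where
  grading : ℤ → Submodule ℚ V
  one_mem : (1 : V) ∈ grading 0
  mul_mem : ∀ {i j : ℤ} {a b : V}, a ∈ grading i → b ∈ grading j → a * b ∈ grading (i + j)
  decomposition : DirectSum.Decomposition grading
  super_comm : ∀ {i j : ℤ} {a b : V}, a ∈ grading i → b ∈ grading j →
    a * b = ((-1 : ℚ) ^ (i * j)) • (b * a)

/-- A linear operator has degree one if it raises the degree by 1. -/
def IsDegreeOne {V : Type*} [Ring V] [Algebra ℚ V] (G : GradedCommAlg V)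
    (D : V →ₗ[ℚ] V) : Prop :=
  ∀ (i : ℤ) (a : V), a ∈ G.grading i → D a ∈ G.grading (i + 1)

/-- The antibracket `{a,b} = (-1)^|a| Δ(a·b) - (-1)^|a| Δ(a)·b - a·Δ(b)` associated to a
degree-1 operator `Δ`, for `a` homogeneous of degree `i`. -/
noncomputable def antibracket {V : Type*} [Ring V] [Algebra ℚ V] (Δ : V →ₗ[ℚ] V)
    (i : ℤ) (a b : V) : V :=
  ((-1 : ℚ) ^ i) • Δ (a * b) - ((-1 : ℚ) ^ i) • (Δ a * b) - a * Δ b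


/-- if `Δ` is a degree-1 operator with `Δ ∘ Δ = 0` on a ℤ-graded commutative
algebra over ℚ, then `Δ` is a graded derivation of its own antibracket:
`Δ({a,b}) = {Δ(a), b} + (-1)^(|a|+1) {a, Δ(b)}` for all homogeneous `a`, `b`. -/
theorem bv_derivation_of_antibracket {V : Type*} [Ring V] [Algebra ℚ V]
    (G : GradedCommAlg V) (Δ : V →ₗ[ℚ] V) (hΔ : IsDegreeOne G Δ)
    (hΔΔ : Δ ∘ₗ Δ = 0)
    (i j : ℤ) (a b : V) (ha : a ∈ G.grading i) (hb : b ∈ G.grading j) :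
    Δ (antibracket Δ i a b) =
      antibracket Δ (i + 1) (Δ a) b +
        ((-1 : ℚ) ^ (i + 1)) • antibracket Δ i a (Δ b) := by
  have hsq (x : V) : Δ (Δ x) = 0 := LinearMap.congr_fun hΔΔ x
  have hsucc : (-1 : ℚ) ^ (i + 1) = -(-1 : ℚ) ^ i := by
    rw [zpow_add_one₀ (by norm_num), mul_neg_one]
  have hmul : (-1 : ℚ) ^ i * (-1 : ℚ) ^ i = 1 := by
    rw [← mul_zpow]; norm_num
  simp only [antibracket, map_sub, map_smul, hsq, hsucc, smul_sub, smul_smul, neg_mul, hmul,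
    neg_smul, one_smul, zero_mul, mul_zero, smul_zero]
  abel
end

section
/- Let V be a ℤ-graded commutative algebra over ℚ and let Δ: V → V be a degree-1 second-order differential operator with Δ(1) = 0 and Δ∘Δ = 0. Then the antibracket associated to Δ satisfies the graded Jacobi identity of a Lie bracket of degree 1: for all homogeneous a, b, c ∈ V, {a,{b,c}} = {{a,b},c} + (−1)^{(|a|+1)(|b|+1)} {b,{a,c}}. -/
/-- A degree-1 operator is a second-order differential operator if its antibracket
satisfies the Leibniz rule `{a, b·c} = {a,b}·c + (-1)^((|a|+1)|b|) b·{a,c}` for all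
homogeneous `a`, `b`, `c`. -/
def IsSecondOrder {V : Type*} [Ring V] [Algebra ℚ V] (G : GradedCommAlg V)
    (Δ : V →ₗ[ℚ] V) : Prop :=
  ∀ (i j k : ℤ) (a b c : V), a ∈ G.grading i → b ∈ G.grading j → c ∈ G.grading k →
    antibracket Δ i a (b * c) =
      antibracket Δ i a b * c + ((-1 : ℚ) ^ ((i + 1) * j)) • (b * antibracket Δ i a c)

/-- if `Δ` is a degree-1 second-order differential operator with `Δ(1) = 0`
and `Δ ∘ Δ = 0`, then its antibracket satisfies the graded Jacobi identity of a Lie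
bracket of degree 1:
`{a,{b,c}} = {{a,b},c} + (-1)^((|a|+1)(|b|+1)) {b,{a,c}}` for homogeneous `a`, `b`, `c`. -/
theorem antibracket_jacobi {V : Type*} [Ring V] [Algebra ℚ V]
    (G : GradedCommAlg V) (Δ : V →ₗ[ℚ] V) (hΔ : IsDegreeOne G Δ)
    (hsecond : IsSecondOrder G Δ) (hone : Δ 1 = 0) (hΔΔ : Δ ∘ₗ Δ = 0)
    (i j k : ℤ) (a b c : V)
    (ha : a ∈ G.grading i) (hb : b ∈ G.grading j) (hc : c ∈ G.grading k) :
    antibracket Δ i a (antibracket Δ j b c) =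
      antibracket Δ (i + j + 1) (antibracket Δ i a b) c +
        ((-1 : ℚ) ^ ((i + 1) * (j + 1))) • antibracket Δ j b (antibracket Δ i a c) := by
  have hsq (x : V) : Δ (Δ x) = 0 := LinearMap.congr_fun hΔΔ x
  have leibniz_abc := hsecond i j k a b c ha hb hc
  have leibniz_Δa := hsecond (i + 1) j k (Δ a) b c (hΔ i a ha) hb hc
  have leibniz_Δb := hsecond i (j + 1) k a (Δ b) c ha (hΔ j b hb) hc
  have leibniz_Δc := hsecond i j (k + 1) a b (Δ c) ha hb (hΔ k c hc)
  have Δ_leibniz_abc := congrArg Δ leibniz_abc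
  have sign_ne : (-1 : ℚ) ≠ 0 := by norm_num
  rcases Int.even_or_odd i with hi | hi <;> rcases Int.even_or_odd j with hj | hj <;>
  · have sign_i := hi.neg_one_zpow (α := ℚ)
    have sign_j := hj.neg_one_zpow (α := ℚ)
    simp only [antibracket, zpow_add₀ sign_ne, zpow_mul, zpow_one, sign_i, sign_j, one_zpow,
      mul_one, mul_neg, neg_neg, one_smul, neg_smul, map_sub, map_add, map_neg, hsq,
      mul_sub, sub_mul, neg_mul, mul_zero, zero_mul, mul_assoc]
      at leibniz_Δa leibniz_Δb leibniz_Δc Δ_leibniz_abc ⊢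
    linear_combination (norm := (simp only [sign_i, sign_j]; module))
      (-((-1 : ℚ) ^ i * (-1 : ℚ) ^ j)) • Δ_leibniz_abc - ((-1 : ℚ) ^ j) • leibniz_Δb
        - leibniz_Δc + ((-1 : ℚ) ^ i * (-1 : ℚ) ^ j) • leibniz_Δa
end
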